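/- Assume q1 ≡ 0 and q2 is C² on a neighborhood of [0,1] with q2' ≤ 0 and q2'' ≤ 0 on [0,1]. Then f'' ≥ 0 and h' ≤ 0 on [0,1], and for all 0 ≤ c_+ < c_- ≤ 1 the shock function satisfies ∂S/∂c_-(c_+,c_-) ≥ 0 ≥ ∂S/∂c_+(c_+,c_-). -/

import Mathlib

open Set

/-- `h = q1 + q2`. -/
noncomputable def hFun (q1 q2 : ℝ → ℝ) : ℝ → ℝ := fun c => q1 c + q2 c

/-- `f(c) = q1(c) - c·h(c)`. -/
noncomputable def fFun (q1 q2 : ℝ → ℝ) : ℝ → ℝ := fun c => q1 c - c * hFun q1 q2 c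

/-- `α(c₊,c₋) = (f(c₊) - f(c₋))/(c₊ - c₋) + 1`. -/
noncomputable def alphaFun (q1 q2 : ℝ → ℝ) (a b : ℝ) : ℝ :=
  (fFun q1 q2 a - fFun q1 q2 b) / (a - b) + 1

/-- `S(c₊,c₋) = log((α + h(c₊))/(α + h(c₋)))`, the jump of `log u` across a shock. -/
noncomputable def SFun (q1 q2 : ℝ → ℝ) (a b : ℝ) : ℝ :=
  Real.log ((alphaFun q1 q2 a b + hFun q1 q2 a) / (alphaFun q1 q2 a b + hFun q1 q2 b))

theorem SFun_eq_aux (q : ℝ → ℝ) (a b : ℝ) (hab : a ≠ b) :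
    SFun (fun _ => 0) q a b
      = Real.log (((b - a) - b * (q b - q a)) / ((b - a) - a * (q b - q a))) := by
  have h1 : a - b ≠ 0 := sub_ne_zero.mpr hab
  have h2 : b - a ≠ 0 := sub_ne_zero.mpr hab.symm
  unfold SFun alphaFun fFun hFun
  have e1 : (0 - a * (0 + q a) - (0 - b * (0 + q b))) / (a - b) + 1 + (0 + q a)
      = ((b - a) - b * (q b - q a)) / (b - a) := by
    rw [eq_div_iff h2, ← neg_sub a b]
    field_simp
    ring
  have e2 : (0 - a * (0 + q a) - (0 - b * (0 + q b))) / (a - b) + 1 + (0 + q b)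
      = ((b - a) - a * (q b - q a)) / (b - a) := by
    rw [eq_div_iff h2, ← neg_sub a b]
    field_simp
    ring
  simp only [e1, e2]
  rw [div_div_div_cancel_right₀ h2]

/-- Inert gas with a concave decreasing isotherm: `f'' ≥ 0`, `h' ≤ 0` on `[0,1]`
and the shock curves are monotonous: `∂S/∂c₋ ≥ 0 ≥ ∂S/∂c₊`. -/
theorem inert_concave_isotherm_assumptions
    (q2 : ℝ → ℝ)
    (hreg : ∃ U : Set ℝ, IsOpen U ∧ Icc (0:ℝ) 1 ⊆ U ∧ ContDiffOn ℝ 2 q2 U)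
    (hq2' : ∀ c ∈ Icc (0:ℝ) 1, deriv q2 c ≤ 0)
    (hq2'' : ∀ c ∈ Icc (0:ℝ) 1, deriv (deriv q2) c ≤ 0) :
    (∀ c ∈ Icc (0:ℝ) 1,
        0 ≤ deriv (deriv (fFun (fun _ => 0) q2)) c ∧
        deriv (hFun (fun _ => 0) q2) c ≤ 0) ∧
    (∀ cp cm : ℝ, 0 ≤ cp → cp < cm → cm ≤ 1 →
        0 ≤ deriv (fun b => SFun (fun _ => 0) q2 cp b) cm ∧
        deriv (fun a => SFun (fun _ => 0) q2 a cm) cp ≤ 0) := by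
  obtain ⟨U, hU, hsub, hC⟩ := hreg
  have hd : ∀ x ∈ U, DifferentiableAt ℝ q2 x := fun x hx =>
    ((hC.contDiffAt (hU.mem_nhds hx)).differentiableAt (by norm_num))
  have hdd : ∀ x ∈ U, DifferentiableAt ℝ (deriv q2) x := by
    have h := ((contDiffOn_succ_iff_deriv_of_isOpen (n := 1) hU).1 (by simpa [one_add_one_eq_two] using hC)).2.2
    intro x hx
    exact (h.contDiffAt (hU.mem_nhds hx)).differentiableAt (by norm_num)
  refine ⟨fun c hc => ⟨?_, ?_⟩, fun a b ha hab hb => ?_⟩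
  · have hev : deriv (fFun (fun _ => 0) q2) =ᶠ[nhds c] fun x => -(q2 x + x * deriv q2 x) := by
      filter_upwards [hU.mem_nhds (hsub hc)] with x hx
      have h1 := ((hasDerivAt_id x).mul (hd x hx).hasDerivAt).neg
      have h2 : fFun (fun _ => 0) q2 = -(id * q2) := by
        funext y; simp [fFun, hFun]
      rw [h2, h1.deriv]; simp
    rw [hev.deriv_eq]
    have h1 := ((hd c (hsub hc)).hasDerivAt.add
      ((hasDerivAt_id c).mul (hdd c (hsub hc)).hasDerivAt)).neg
    have h2 : (fun x => -(q2 x + x * deriv q2 x)) = -(q2 + id * deriv q2) := by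
      funext y; simp
    rw [h2, h1.deriv]
    have := mul_nonneg hc.1 (neg_nonneg.2 (hq2'' c hc))
    have := hq2' c hc
    simp only [id]
    linarith
  · have h2 : hFun (fun _ => 0) q2 = q2 := by
      funext y; simp [hFun]
    rw [h2]; exact hq2' c hc
  · have haI : a ∈ Icc (0:ℝ) 1 := ⟨ha, by linarith⟩
    have hbI : b ∈ Icc (0:ℝ) 1 := ⟨by linarith, hb⟩
    have hanti : AntitoneOn q2 (Icc 0 1) := by
      apply antitoneOn_of_deriv_nonpos (convex_Icc 0 1)
      · exact fun x hx => (hd x (hsub hx)).continuousAt.continuousWithinAt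
      · exact fun x hx => (hd x (hsub (interior_subset hx))).differentiableWithinAt
      · exact fun x hx => hq2' x (interior_subset hx)
    have hΔ : q2 b - q2 a ≤ 0 := sub_nonpos.2 (hanti haI hbI hab.le)
    have hN : 0 < (b - a) - b * (q2 b - q2 a) := by
      have := mul_nonneg hbI.1 (neg_nonneg.2 hΔ)
      linarith
    have hD : 0 < (b - a) - a * (q2 b - q2 a) := by
      have := mul_nonneg haI.1 (neg_nonneg.2 hΔ)
      linarith
    have hquot := (div_pos hN hD).ne'
    have hqa := (hd a (hsub haI)).hasDerivAt
    have hqb := (hd b (hsub hbI)).hasDerivAt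
    constructor
    · have hev : (fun y => SFun (fun _ => 0) q2 a y) =ᶠ[nhds b] fun y =>
          Real.log (((y - a) - y * (q2 y - q2 a)) / ((y - a) - a * (q2 y - q2 a))) := by
        filter_upwards [isOpen_ne.mem_nhds hab.ne'] with y hy
        exact SFun_eq_aux q2 a y (Ne.symm hy)
      rw [hev.deriv_eq]
      have h1 : HasDerivAt (fun y => (y - a) - y * (q2 y - q2 a))
          (1 - (1 * (q2 b - q2 a) + b * deriv q2 b)) b :=
        ((hasDerivAt_id' b).sub_const a).sub ((hasDerivAt_id' b).mul (hqb.sub_const _))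
      have h2 : HasDerivAt (fun y => (y - a) - a * (q2 y - q2 a))
          (1 - a * deriv q2 b) b :=
        ((hasDerivAt_id' b).sub_const a).sub ((hqb.sub_const _).const_mul a)
      rw [((h1.fun_div h2 hD.ne').log hquot).deriv]
      apply div_nonneg _ (div_pos hN hD).le
      apply div_nonneg _ (sq_nonneg _)
      have e1 := mul_nonneg ha (sq_nonneg (q2 b - q2 a))
      have e2 := mul_nonneg (sq_nonneg (b - a)) (neg_nonneg.2 (hq2' b hbI))
      linarith
    · have hev : (fun y => SFun (fun _ => 0) q2 y b) =ᶠ[nhds a] fun y =>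
          Real.log (((b - y) - b * (q2 b - q2 y)) / ((b - y) - y * (q2 b - q2 y))) := by
        filter_upwards [isOpen_ne.mem_nhds hab.ne] with y hy
        exact SFun_eq_aux q2 y b hy
      rw [hev.deriv_eq]
      have h1 : HasDerivAt (fun y => (b - y) - b * (q2 b - q2 y))
          (-1 - b * (-deriv q2 a)) a :=
        ((hasDerivAt_id' a).const_sub b).sub ((hqa.const_sub _).const_mul b)
      have h2 : HasDerivAt (fun y => (b - y) - y * (q2 b - q2 y))
          (-1 - (1 * (q2 b - q2 a) + a * (-deriv q2 a))) a :=
        ((hasDerivAt_id' a).const_sub b).sub ((hasDerivAt_id' a).mul (hqa.const_sub _))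
      rw [((h1.fun_div h2 hD.ne').log hquot).deriv]
      apply div_nonpos_of_nonpos_of_nonneg _ (div_pos hN hD).le
      apply div_nonpos_of_nonpos_of_nonneg _ (sq_nonneg _)
      have e1 := mul_nonneg hbI.1 (sq_nonneg (q2 b - q2 a))
      have e2 := mul_nonneg (sq_nonneg (b - a)) (neg_nonneg.2 (hq2' a haI))
      linarith
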